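/- Local correctness of the non-deterministic rules: let S and S′ be constraint systems generated by the optimised algorithm from {x₀ ⊨ φ}, and let S′ be obtained from S by an application of the →∨-rule or of the →≥-rule. Then (a) if S′ is satisfiable, so is S; and (b) if S is satisfiable, then the rule in question can be applied in such a way that the resulting constraint system S′ is satisfiable. -/

import Mathlib

/-! Core definitions for the graded modal logic Gr(K_R):
syntax, Kripke semantics, NNF, closure, constraint systems,
and the completion rules (optimised and standard). -/

namespace GrK

/-- Gr(K_R)-formulae over propositional atoms (ℕ) and relation names (ℕ).
`ge r n φ` is the counting modality ⟨R⟩_{≥n}φ and `le r n φ` is ⟨R⟩_{≤n}φ. -/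
inductive GFormula : Type where
  | atom : ℕ → GFormula
  | neg  : GFormula → GFormula
  | and  : GFormula → GFormula → GFormula
  | or   : GFormula → GFormula → GFormula
  | ge   : ℕ → ℕ → GFormula → GFormula
  | le   : ℕ → ℕ → GFormula → GFormula
  deriving DecidableEq

/-- A Kripke structure: a nonempty type of worlds, an accessibility relation
for each relation name, and a valuation. -/
structure Kripke where
  W : Type
  nonempty : Nonempty W
  rel : ℕ → W → W → Prop
  val : ℕ → Set W

/-- Satisfaction `M, x ⊨ φ`; the graded modalities count successors
(as a cardinal, to handle infinite structures faithfully). -/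
def GFormula.sat (M : Kripke) : GFormula → M.W → Prop
  | .atom p, x => x ∈ M.val p
  | .neg φ, x => ¬ GFormula.sat M φ x
  | .and φ ψ, x => GFormula.sat M φ x ∧ GFormula.sat M ψ x
  | .or φ ψ, x => GFormula.sat M φ x ∨ GFormula.sat M ψ x
  | .ge r n φ, x => (n : Cardinal) ≤ Cardinal.mk {y : M.W // M.rel r x y ∧ GFormula.sat M φ y}
  | .le r n φ, x => Cardinal.mk {y : M.W // M.rel r x y ∧ GFormula.sat M φ y} ≤ (n : Cardinal)

/-- ♯R^M(x,φ): the number of R-successors of x satisfying φ. -/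
def Kripke.count (M : Kripke) (r : ℕ) (x : M.W) (φ : GFormula) : Cardinal :=
  Cardinal.mk {y : M.W // M.rel r x y ∧ GFormula.sat M φ y}

/-- A formula is satisfiable iff it holds at some world of some Kripke structure. -/
def GFormula.satisfiable (φ : GFormula) : Prop :=
  ∃ (M : Kripke) (x : M.W), GFormula.sat M φ x

/-- Negation normal form: negation occurs only in front of atoms. -/
def GFormula.isNNF : GFormula → Prop
  | .atom _ => True
  | .neg (.atom _) => True
  | .neg _ => False
  | .and φ ψ => GFormula.isNNF φ ∧ GFormula.isNNF ψ
  | .or φ ψ => GFormula.isNNF φ ∧ GFormula.isNNF ψ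
  | .ge _ _ φ => GFormula.isNNF φ
  | .le _ _ φ => GFormula.isNNF φ

/-- ~φ : the NNF of the negation of an NNF formula. -/
def GFormula.nnfNeg : GFormula → GFormula
  | .atom p => .neg (.atom p)
  | .neg φ => φ
  | .and φ ψ => .or φ.nnfNeg ψ.nnfNeg
  | .or φ ψ => .and φ.nnfNeg ψ.nnfNeg
  | .ge r n φ => if n = 0 then .and (.atom 0) (.neg (.atom 0)) else .le r (n - 1) φ
  | .le r n φ => .ge r (n + 1) φ

/-- |φ| : the length of a formula. -/
def GFormula.size : GFormula → ℕ
  | .atom _ => 1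
  | .neg φ => 1 + φ.size
  | .and φ ψ => 1 + φ.size + ψ.size
  | .or φ ψ => 1 + φ.size + ψ.size
  | .ge _ _ φ => 1 + φ.size
  | .le _ _ φ => 1 + φ.size

/-- sub(φ) : the set of subformulae of φ. -/
def GFormula.sub : GFormula → Finset GFormula
  | .atom p => {.atom p}
  | .neg φ => insert (.neg φ) φ.sub
  | .and φ ψ => insert (.and φ ψ) (φ.sub ∪ ψ.sub)
  | .or φ ψ => insert (.or φ ψ) (φ.sub ∪ ψ.sub)
  | .ge r n φ => insert (.ge r n φ) φ.sub
  | .le r n φ => insert (.le r n φ) φ.sub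

/-- Membership in clos(φ): the smallest set containing φ, closed under
immediate subformulae of ∧, ∨ and the graded modalities, and closed under ~. -/
inductive InClos (φ : GFormula) : GFormula → Prop
  | base : InClos φ φ
  | andL {ψ₁ ψ₂} : InClos φ (.and ψ₁ ψ₂) → InClos φ ψ₁
  | andR {ψ₁ ψ₂} : InClos φ (.and ψ₁ ψ₂) → InClos φ ψ₂
  | orL {ψ₁ ψ₂} : InClos φ (.or ψ₁ ψ₂) → InClos φ ψ₁
  | orR {ψ₁ ψ₂} : InClos φ (.or ψ₁ ψ₂) → InClos φ ψ₂
  | ge {r n ψ} : InClos φ (.ge r n ψ) → InClos φ ψ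
  | le {r n ψ} : InClos φ (.le r n ψ) → InClos φ ψ
  | nnfNeg {ψ} : InClos φ ψ → InClos φ ψ.nnfNeg

/-- clos(φ) as a set of formulae. -/
def clos (φ : GFormula) : Set GFormula := {ψ | InClos φ ψ}

/-- A constraint: either `x ⊨ ψ` or `R x y`;
a constraint system (c.s.) is a finite set of constraints. -/
inductive Constraint : Type where
  | sat : ℕ → GFormula → Constraint
  | rel : ℕ → ℕ → ℕ → Constraint
  deriving DecidableEq

/-- The variables occurring in a constraint. -/
def Constraint.vars : Constraint → Finset ℕ
  | .sat x _ => {x}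
  | .rel _ x y => {x, y}

/-- ♯R^S(x,ψ): the number of variables y with {Rxy, y ⊨ ψ} ⊆ S. -/
noncomputable def countS (S : Finset Constraint) (r x : ℕ) (ψ : GFormula) : ℕ :=
  Set.ncard {y : ℕ | Constraint.rel r x y ∈ S ∧ Constraint.sat y ψ ∈ S}

/-- A clash: {x ⊨ p, x ⊨ ¬p} ⊆ S, or x ⊨ ⟨R⟩_{≤n}ψ ∈ S with ♯R^S(x,ψ) > n. -/
def hasClash (S : Finset Constraint) : Prop :=
  (∃ x p, Constraint.sat x (.atom p) ∈ S ∧ Constraint.sat x (.neg (.atom p)) ∈ S) ∨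
  (∃ x r n ψ, Constraint.sat x (.le r n ψ) ∈ S ∧ n < countS S r x ψ)

/-- `y` is a fresh variable w.r.t. S. -/
def freshIn (y : ℕ) (S : Finset Constraint) : Prop := ∀ c ∈ S, y ∉ c.vars

/-- The →∧-rule is applicable to a constraint for x in S. -/
def andApplicable (S : Finset Constraint) (x : ℕ) : Prop :=
  ∃ ψ₁ ψ₂, Constraint.sat x (.and ψ₁ ψ₂) ∈ S ∧
    ¬ (Constraint.sat x ψ₁ ∈ S ∧ Constraint.sat x ψ₂ ∈ S)

/-- The →∨-rule is applicable to a constraint for x in S. -/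
def orApplicable (S : Finset Constraint) (x : ℕ) : Prop :=
  ∃ ψ₁ ψ₂, Constraint.sat x (.or ψ₁ ψ₂) ∈ S ∧
    Constraint.sat x ψ₁ ∉ S ∧ Constraint.sat x ψ₂ ∉ S

/-- One application of the →∧-rule. -/
inductive StepAnd : Finset Constraint → Finset Constraint → Prop
  | mk (S : Finset Constraint) (x : ℕ) (ψ₁ ψ₂ : GFormula)
      (h : Constraint.sat x (.and ψ₁ ψ₂) ∈ S)
      (h2 : ¬ (Constraint.sat x ψ₁ ∈ S ∧ Constraint.sat x ψ₂ ∈ S)) :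
      StepAnd S (insert (Constraint.sat x ψ₁) (insert (Constraint.sat x ψ₂) S))

/-- One application of the →∨-rule. -/
inductive StepOr : Finset Constraint → Finset Constraint → Prop
  | mk (S : Finset Constraint) (x : ℕ) (ψ₁ ψ₂ χ : GFormula)
      (h : Constraint.sat x (.or ψ₁ ψ₂) ∈ S)
      (h1 : Constraint.sat x ψ₁ ∉ S) (h2 : Constraint.sat x ψ₂ ∉ S)
      (hχ : χ = ψ₁ ∨ χ = ψ₂) :
      StepOr S (insert (Constraint.sat x χ) S)

/-- One application of the optimised →≥-rule: if x ⊨ ⟨R⟩_{≥n}ψ ∈ S,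
♯R^S(x,ψ) < n and no →∧/→∨ rule applies to a constraint for x, add (for a
fresh y) the constraints Rxy, y ⊨ ψ, and y ⊨ χᵢ with χᵢ ∈ {ψᵢ, ~ψᵢ} for every
ψᵢ occurring in a graded constraint ⟨R⟩_{⋈m}ψᵢ for x with the same relation R. -/
inductive StepGe : Finset Constraint → Finset Constraint → Prop
  | mk (S S' : Finset Constraint) (x r n : ℕ) (ψ : GFormula) (y : ℕ)
      (f : GFormula → GFormula)
      (h : Constraint.sat x (.ge r n ψ) ∈ S)
      (hc : countS S r x ψ < n)
      (hna : ¬ andApplicable S x) (hno : ¬ orApplicable S x)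
      (hy : freshIn y S)
      (hf : ∀ ψ', f ψ' = ψ' ∨ f ψ' = ψ'.nnfNeg)
      (hS' : (S' : Set Constraint) = (S : Set Constraint) ∪
          {Constraint.rel r x y, Constraint.sat y ψ} ∪
          {c | ∃ ψ' m,
            (Constraint.sat x (.ge r m ψ') ∈ S ∨ Constraint.sat x (.le r m ψ') ∈ S) ∧
            c = Constraint.sat y (f ψ')}) :
      StepGe S S'

/-- One application of any optimised completion rule. -/
def OptStep (S S' : Finset Constraint) : Prop := StepAnd S S' ∨ StepOr S S' ∨ StepGe S S'

/-- The initial constraint system {x₀ ⊨ φ}. -/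
def initCS (x₀ : ℕ) (φ : GFormula) : Finset Constraint := {Constraint.sat x₀ φ}

/-- S is obtained from {x₀ ⊨ φ} by a sequence of optimised rule applications. -/
def OptReach (x₀ : ℕ) (φ : GFormula) (S : Finset Constraint) : Prop :=
  Relation.ReflTransGen OptStep (initCS x₀ φ) S

/-- A c.s. is complete iff no optimised rule is applicable. -/
def OptComplete (S : Finset Constraint) : Prop := ¬ ∃ S', OptStep S S'

/-- The edges of the graph G(S) induced by a c.s. S. -/
def edge (S : Finset Constraint) (x y : ℕ) : Prop := ∃ r, Constraint.rel r x y ∈ S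

/-- The variable x occurs in S (x is a node of G(S)). -/
def occursIn (x : ℕ) (S : Finset Constraint) : Prop := ∃ c ∈ S, x ∈ c.vars

/-- Satisfiability of a constraint system. -/
def csSat (S : Finset Constraint) : Prop :=
  ∃ (M : Kripke) (α : ℕ → M.W),
    (∀ r x y z, Constraint.rel r x y ∈ S → Constraint.rel r x z ∈ S → y ≠ z → α y ≠ α z) ∧
    (∀ x ψ, Constraint.sat x ψ ∈ S → GFormula.sat M ψ (α x)) ∧
    (∀ r x y, Constraint.rel r x y ∈ S → M.rel r (α x) (α y))

/-- The canonical structure M_S induced by a c.s. S (on the variables,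
with accessibility and valuation read off from S). -/
def canonical (S : Finset Constraint) : Kripke where
  W := ℕ
  nonempty := ⟨0⟩
  rel := fun r x y => Constraint.rel r x y ∈ S
  val := fun p => {x | Constraint.sat x (.atom p) ∈ S}

/-- Renaming a variable: `rename y z c` replaces y by z in the constraint c. -/
def Constraint.rename (y z : ℕ) : Constraint → Constraint
  | .sat x ψ => .sat (if x = y then z else x) ψ
  | .rel r a b => .rel r (if a = y then z else a) (if b = y then z else b)

/-- [z/y]S : replace every occurrence of y by z in S. -/
def renameCS (S : Finset Constraint) (y z : ℕ) : Finset Constraint :=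
  S.image (Constraint.rename y z)

/-- The replacement of y by z in S is safe. -/
def safeReplace (S : Finset Constraint) (y z : ℕ) : Prop :=
  ∀ x r n ψ, Constraint.sat x (.ge r n ψ) ∈ S → Constraint.rel r x y ∈ S →
    Constraint.rel r x z ∈ S → n ≤ countS (renameCS S y z) r x ψ

/-- One application of a standard (Hollunder–Baader) completion rule. -/
inductive StdStep : Finset Constraint → Finset Constraint → Prop
  | and (S : Finset Constraint) (x : ℕ) (ψ₁ ψ₂ : GFormula)
      (h : Constraint.sat x (.and ψ₁ ψ₂) ∈ S)
      (h2 : ¬ (Constraint.sat x ψ₁ ∈ S ∧ Constraint.sat x ψ₂ ∈ S)) :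
      StdStep S (insert (Constraint.sat x ψ₁) (insert (Constraint.sat x ψ₂) S))
  | or (S : Finset Constraint) (x : ℕ) (ψ₁ ψ₂ χ : GFormula)
      (h : Constraint.sat x (.or ψ₁ ψ₂) ∈ S)
      (h1 : Constraint.sat x ψ₁ ∉ S) (h2 : Constraint.sat x ψ₂ ∉ S)
      (hχ : χ = ψ₁ ∨ χ = ψ₂) :
      StdStep S (insert (Constraint.sat x χ) S)
  | choose (S : Finset Constraint) (x r n : ℕ) (ψ χ : GFormula) (y : ℕ)
      (h : Constraint.sat x (.ge r n ψ) ∈ S ∨ Constraint.sat x (.le r n ψ) ∈ S)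
      (hr : Constraint.rel r x y ∈ S)
      (h1 : Constraint.sat y ψ ∉ S) (h2 : Constraint.sat y ψ.nnfNeg ∉ S)
      (hχ : χ = ψ ∨ χ = ψ.nnfNeg) :
      StdStep S (insert (Constraint.sat y χ) S)
  | ge (S : Finset Constraint) (x r n : ℕ) (ψ : GFormula) (y : ℕ)
      (h : Constraint.sat x (.ge r n ψ) ∈ S)
      (hc : countS S r x ψ < n)
      (hy : freshIn y S) :
      StdStep S (insert (Constraint.rel r x y) (insert (Constraint.sat y ψ) S))
  | le (S : Finset Constraint) (x r n : ℕ) (ψ : GFormula) (y z : ℕ)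
      (h : Constraint.sat x (.le r n ψ) ∈ S)
      (hc : n < countS S r x ψ)
      (hyz : y ≠ z)
      (h1 : Constraint.rel r x y ∈ S) (h2 : Constraint.rel r x z ∈ S)
      (h3 : Constraint.sat y ψ ∈ S) (h4 : Constraint.sat z ψ ∈ S)
      (hsafe : safeReplace S y z) :
      StdStep S (renameCS S y z)

/-- S is obtained from {x₀ ⊨ φ} by a sequence of standard rule applications. -/
def StdReach (x₀ : ℕ) (φ : GFormula) (S : Finset Constraint) : Prop :=
  Relation.ReflTransGen StdStep (initCS x₀ φ) S

/-- A c.s. is complete (for the standard rules) iff no rule is applicable. -/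
def StdComplete (S : Finset Constraint) : Prop := ¬ ∃ S', StdStep S S'

end GrK

namespace GrK

theorem sat_nnfNeg (M : Kripke) (ψ : GFormula) :
    ∀ w : M.W, ψ.nnfNeg.sat M w ↔ ¬ ψ.sat M w := by
  induction ψ with
  | atom p => intro w; simp [GFormula.nnfNeg, GFormula.sat]
  | neg φ _ => intro w; simp [GFormula.nnfNeg, GFormula.sat]
  | and a b iha ihb => intro w; simp only [GFormula.nnfNeg, GFormula.sat, iha, ihb]; tauto
  | or a b iha ihb => intro w; simp only [GFormula.nnfNeg, GFormula.sat, iha, ihb]; tauto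
  | ge r n φ _ =>
    intro w
    rcases n with _ | n
    · simp [GFormula.nnfNeg, GFormula.sat]
    · simp only [GFormula.nnfNeg, GFormula.sat, Nat.add_eq_zero_iff, one_ne_zero, and_false,
        if_false, Nat.add_sub_cancel, not_le]
      rw [Nat.cast_succ, ← Cardinal.succ_natCast, Order.lt_succ_iff]
  | le r n φ _ =>
    intro w
    simp only [GFormula.nnfNeg, GFormula.sat, not_le]
    rw [Nat.cast_succ, ← Cardinal.succ_natCast, Order.succ_le_iff]

/-- Invariant of the optimised algorithm. -/
def Inv (S : Finset Constraint) : Prop :=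
  ∀ r x y, Constraint.rel r x y ∈ S →
    ¬ andApplicable S x ∧ ¬ orApplicable S x ∧
    ∀ m ψ, (Constraint.sat x (.ge r m ψ) ∈ S ∨ Constraint.sat x (.le r m ψ) ∈ S) →
      Constraint.sat y ψ ∈ S ∨ Constraint.sat y ψ.nnfNeg ∈ S

theorem app_congr {S S' : Finset Constraint} {x : ℕ}
    (h : ∀ ψ, Constraint.sat x ψ ∈ S' ↔ Constraint.sat x ψ ∈ S) :
    (andApplicable S' x ↔ andApplicable S x) ∧ (orApplicable S' x ↔ orApplicable S x) := by
  simp only [andApplicable, orApplicable, h, and_self]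

theorem inv_mono {S S' : Finset Constraint} (hI : Inv S) (hsub : S ⊆ S')
    (hrel : ∀ r x y, Constraint.rel r x y ∈ S' → Constraint.rel r x y ∈ S)
    (hs : ∀ r x y, Constraint.rel r x y ∈ S →
      ∀ ψ, Constraint.sat x ψ ∈ S' ↔ Constraint.sat x ψ ∈ S) : Inv S' := by
  intro r x y hr
  have hr := hrel _ _ _ hr
  have h := hs _ _ _ hr
  obtain ⟨h1, h2, h3⟩ := hI _ _ _ hr
  refine ⟨by rwa [(app_congr h).1], by rwa [(app_congr h).2], fun m ψ hm => ?_⟩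
  rw [h, h] at hm
  exact (h3 m ψ hm).imp (fun a => hsub a) (fun a => hsub a)

theorem inv_step {S S' : Finset Constraint} (hI : Inv S) (hst : OptStep S S') : Inv S' := by
  rcases hst with hst | hst | hst
  · obtain ⟨x, a, b, h, h2⟩ := hst
    refine inv_mono hI (fun c hc => by simp [hc]) (by simp) ?_
    intro r x' y hr ψ
    have hne : x' ≠ x := by
      rintro rfl
      exact (hI _ _ _ hr).1 ⟨a, b, h, h2⟩
    simp [hne]
  · obtain ⟨x, a, b, χ, h, h1, h2, hχ⟩ := hst
    refine inv_mono hI (fun c hc => by simp [hc]) (by simp) ?_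
    intro r x' y hr ψ
    have hne : x' ≠ x := by
      rintro rfl
      exact (hI _ _ _ hr).2.1 ⟨a, b, h, h1, h2⟩
    simp [hne]
  · obtain ⟨x, r, n, ψ, y, f, h, hc, hna, hno, hy, hf, hS'⟩ := hst
    have hm : ∀ c, c ∈ S' ↔ (c ∈ S ∨ (c = Constraint.rel r x y ∨ c = Constraint.sat y ψ)) ∨
        ∃ ψ' m, (Constraint.sat x (.ge r m ψ') ∈ S ∨ Constraint.sat x (.le r m ψ') ∈ S) ∧
            c = Constraint.sat y (f ψ') := by
      intro c
      have := Set.ext_iff.1 hS' c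
      exact this
    have hsat : ∀ x', x' ≠ y → ∀ ψ, Constraint.sat x' ψ ∈ S' ↔ Constraint.sat x' ψ ∈ S := by
      intro x' hx ψ
      rw [hm]; simp [hx]
    have hxy : x ≠ y := by
      rintro rfl
      exact hy _ h (by simp [Constraint.vars])
    intro r' x' y' hr
    rw [hm] at hr
    rcases hr with (hr | hr | hr) | ⟨_, _, _, hr⟩
    · have hx : x' ≠ y := by
        rintro rfl
        exact hy _ hr (by simp [Constraint.vars])
      have e := hsat x' hx
      obtain ⟨h1, h2, h3⟩ := hI _ _ _ hr
      refine ⟨by rwa [(app_congr e).1], by rwa [(app_congr e).2], fun m ψ hmm => ?_⟩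
      rw [e, e] at hmm
      exact (h3 m ψ hmm).imp (fun a => (hm _).2 (Or.inl (Or.inl a)))
        (fun a => (hm _).2 (Or.inl (Or.inl a)))
    · injection hr with e1 e2 e3
      subst e1 e2 e3
      have e := hsat x' hxy
      refine ⟨by rwa [(app_congr e).1], by rwa [(app_congr e).2], fun m ψ' hmm => ?_⟩
      rw [e, e] at hmm
      have : Constraint.sat y' (f ψ') ∈ S' := (hm _).2 (Or.inr ⟨ψ', m, hmm, rfl⟩)
      rcases hf ψ' with e' | e' <;> rw [e'] at this
      · exact Or.inl this
      · exact Or.inr this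
    · cases hr
    · cases hr

theorem inv_reach {x₀ : ℕ} {φ : GFormula} {S : Finset Constraint}
    (h : OptReach x₀ φ S) : Inv S := by
  unfold OptReach at h
  induction h with
  | refl => intro r x y hr; simp [initCS] at hr
  | tail _ hst ih => exact inv_step ih hst

theorem csSat_mono {S S' : Finset Constraint} (h : S ⊆ S') : csSat S' → csSat S := by
  rintro ⟨M, α, h1, h2, h3⟩
  exact ⟨M, α, fun r x y z a b => h1 r x y z (h a) (h b), fun x ψ a => h2 x ψ (h a),
    fun r x y a => h3 r x y (h a)⟩

theorem succ_finite (S : Finset Constraint) (r x : ℕ) (ψ : GFormula) :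
    {y : ℕ | Constraint.rel r x y ∈ S ∧ Constraint.sat y ψ ∈ S}.Finite := by
  have : Set.Finite ((fun y => Constraint.rel r x y) ⁻¹' (S : Set Constraint)) :=
    S.finite_toSet.preimage (fun a _ b _ hab => by injection hab)
  exact this.subset (fun y hy => hy.1)

theorem ge_sat {S : Finset Constraint} (hI : Inv S) {x r n : ℕ} {ψ : GFormula} {y : ℕ}
    (h : Constraint.sat x (.ge r n ψ) ∈ S) (hc : countS S r x ψ < n)
    (hna : ¬ andApplicable S x) (hno : ¬ orApplicable S x) (hy : freshIn y S)
    (hS : csSat S) : ∃ S'', StepGe S S'' ∧ csSat S'' := by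
  classical
  obtain ⟨M, α, h1, h2, h3⟩ := hS
  -- a new witness
  obtain ⟨w, hw, hwψ, hwn⟩ : ∃ w, M.rel r (α x) w ∧ ψ.sat M w ∧
      ∀ z, Constraint.rel r x z ∈ S → α z ≠ w := by
    by_contra hcon
    push Not at hcon
    have hge : (n : Cardinal) ≤ Cardinal.mk {v : M.W // M.rel r (α x) v ∧ ψ.sat M v} := h2 _ _ h
    have hsub : {v : M.W | M.rel r (α x) v ∧ ψ.sat M v} ⊆
        α '' {y : ℕ | Constraint.rel r x y ∈ S ∧ Constraint.sat y ψ ∈ S} := by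
      rintro v ⟨hv1, hv2⟩
      obtain ⟨z, hz, rfl⟩ := hcon v hv1 hv2
      refine ⟨z, ⟨hz, ?_⟩, rfl⟩
      rcases (hI _ _ _ hz).2.2 n ψ (Or.inl h) with h' | h'
      · exact h'
      · exact absurd hv2 ((sat_nnfNeg M ψ _).1 (h2 _ _ h'))
    have hle := (Cardinal.mk_le_mk_of_subset hsub).trans Cardinal.mk_image_le
    have hcard := Set.cast_ncard (succ_finite S r x ψ)
    rw [← hcard] at hle
    have := hge.trans hle
    rw [Nat.cast_le] at this
    exact absurd hc (not_lt.2 this)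
  let f : GFormula → GFormula := fun ψ' => if ψ'.sat M w then ψ' else ψ'.nnfNeg
  have hfsat : ∀ ψ', (f ψ').sat M w := by
    intro ψ'
    by_cases hh : ψ'.sat M w
    · simp [f, hh]
    · simp [f, hh, sat_nnfNeg]
  let T : Set Constraint := (S : Set Constraint) ∪
          {Constraint.rel r x y, Constraint.sat y ψ} ∪
          {c | ∃ ψ' m,
            (Constraint.sat x (.ge r m ψ') ∈ S ∨ Constraint.sat x (.le r m ψ') ∈ S) ∧
            c = Constraint.sat y (f ψ')}
  have hT : T.Finite := by
    refine (S.finite_toSet.union (by simp)).union ?_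
    let g : Constraint → Constraint := fun c => match c with
      | .sat _ (.ge _ _ ψ') => .sat y (f ψ')
      | .sat _ (.le _ _ ψ') => .sat y (f ψ')
      | c => c
    refine (S.finite_toSet.image g).subset ?_
    rintro c ⟨ψ', m, hm | hm, rfl⟩
    · exact ⟨_, hm, rfl⟩
    · exact ⟨_, hm, rfl⟩
  have hcoe : (hT.toFinset : Set Constraint) = T := hT.coe_toFinset
  refine ⟨hT.toFinset, StepGe.mk S _ x r n ψ y f h hc hna hno hy ?_ hcoe, ?_⟩
  · intro ψ'
    by_cases hh : ψ'.sat M w <;> simp [f, hh]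
  have hxy : x ≠ y := by
    rintro rfl
    exact hy _ h (by simp [Constraint.vars])
  have hrelT : ∀ r' a b, Constraint.rel r' a b ∈ hT.toFinset →
      (Constraint.rel r' a b ∈ S ∧ a ≠ y ∧ b ≠ y) ∨ (r' = r ∧ a = x ∧ b = y) := by
    intro r' a b hab
    simp only [Set.Finite.mem_toFinset] at hab
    rcases hab with (hr | hr | hr) | ⟨_, _, _, hr⟩
    · refine Or.inl ⟨hr, ?_, ?_⟩ <;> rintro rfl <;> exact hy _ hr (by simp [Constraint.vars])
    · injection hr with e1 e2 e3
      exact Or.inr ⟨e1, e2, e3⟩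
    · cases hr
    · cases hr
  refine ⟨M, Function.update α y w, ?_, ?_, ?_⟩
  · intro r' a b c hab hac hbc
    rcases hrelT _ _ _ hab with ⟨hb, _, hb'⟩ | ⟨rfl, rfl, rfl⟩ <;>
    rcases hrelT _ _ _ hac with ⟨hc, _, hc'⟩ | ⟨e1, e2, e3⟩
    · simpa [hb', hc'] using h1 _ _ _ _ hb hc hbc
    · subst e1 e2 e3
      simpa [hb'] using hwn _ hb
    · simpa [hc'] using (hwn _ hc).symm
    · exact absurd e3.symm hbc
  · intro a χ ha
    simp only [Set.Finite.mem_toFinset] at ha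
    rcases ha with (hr | hr | hr) | ⟨ψ', m, _, hr⟩
    · have : a ≠ y := by
        rintro rfl
        exact hy _ hr (by simp [Constraint.vars])
      simpa [this] using h2 _ _ hr
    · cases hr
    · injection hr with e1 e2
      subst e1 e2
      simpa using hwψ
    · injection hr with e1 e2
      subst e1 e2
      simpa using hfsat ψ'
  · intro r' a b hab
    rcases hrelT _ _ _ hab with ⟨hb, ha', hb'⟩ | ⟨rfl, rfl, rfl⟩
    · simpa [ha', hb'] using h3 _ _ _ hb
    · simpa [hxy] using hw

end GrK

open GrK in
/-- local correctness of the non-deterministic rules: if S is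
generated by the optimised algorithm from {x₀ ⊨ φ} and S' is obtained from S
by the →∨- or →≥-rule, then (a) satisfiability of S' implies satisfiability
of S, and (b) if S is satisfiable then the rule in question can be applied so
that the resulting system is satisfiable. -/
theorem stmt_10 (φ : GFormula) (hNNF : φ.isNNF) (x₀ : ℕ) (S S' : Finset Constraint)
    (hreach : OptReach x₀ φ S) :
    ((StepOr S S' ∨ StepGe S S') → csSat S' → csSat S) ∧
    (StepOr S S' → csSat S → ∃ S'', StepOr S S'' ∧ csSat S'') ∧
    (StepGe S S' → csSat S → ∃ S'', StepGe S S'' ∧ csSat S'') := by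
  refine ⟨?_, ?_, ?_⟩
  · rintro (hst | hst)
    · obtain ⟨x, a, b, χ, h, h1, h2, hχ⟩ := hst
      exact csSat_mono (fun c hc => by simp [hc])
    · obtain ⟨x, r, n, ψ, y, f, h, hc, hna, hno, hy, hf, hS'⟩ := hst
      refine csSat_mono (fun c hc => ?_)
      have : c ∈ (S' : Set Constraint) := by
        rw [hS']
        exact Or.inl (Or.inl hc)
      exact this
  · rintro ⟨x, a, b, χ, h, h1, h2, hχ⟩ ⟨M, α, k1, k2, k3⟩
    have hor : a.sat M (α x) ∨ b.sat M (α x) := k2 _ _ h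
    have key : ∀ χ', (χ' = a ∨ χ' = b) → χ'.sat M (α x) →
        ∃ S'', StepOr S S'' ∧ csSat S'' := by
      intro χ' hχ' hs
      refine ⟨_, StepOr.mk S x a b χ' h h1 h2 hχ', M, α, ?_, ?_, ?_⟩
      · intro r x' y z hy hz
        simp only [Finset.mem_insert, reduceCtorEq, false_or] at hy hz
        exact k1 r x' y z hy hz
      · intro x' ψ hψ
        rcases Finset.mem_insert.1 hψ with e | e
        · injection e with e1 e2
          subst e1 e2
          exact hs
        · exact k2 _ _ e
      · intro r x' y hy
        simp only [Finset.mem_insert, reduceCtorEq, false_or] at hy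
        exact k3 r x' y hy
    rcases hor with hs | hs
    · exact key a (Or.inl rfl) hs
    · exact key b (Or.inr rfl) hs
  · rintro ⟨x, r, n, ψ, y, f, h, hc, hna, hno, hy, hf, hS'⟩ hs
    exact ge_sat (inv_reach hreach) h hc hna hno hy hs
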